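/- Let t,n be positive integers, let P be a finite semipure poset of length n having a unique maximum element, and let λ_P : Cov(P̂) → L_P be an EL-labeling of P̂. Let λ be the EL-labeling of (P∗T_{t,n})^ obtained by applying the Rees-product EL-labeling construction to λ_P and the constant semi-EL-labeling of T_{t,n} (every edge labeled 1). For a sequence w = (w₁,…,w_{n+1}) ∈ L_P^{n+1}, let c(w) be the number of maximal chains of P ⊎ {0̂_P} (P with a new minimum adjoined, edges labeled by λ_P) whose label sequence is w. Then the number of ascent-free maximal chains of (P∗T_{t,n})^ of length n+2 equals the sum, over all w ∈ L_P^{n+1} that have no double ascent and satisfy w₁ ≰ w₂ and w_n ≰ w_{n+1}, of c(w)·t^{asc(w)+1}(1+t)^{n−1−2·asc(w)}. -/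

import Mathlib

/-! Statement 1: counting ascent-free maximal chains of `(P ∗ T_{t,n})^` when `P` has a unique maximum. -/

attribute [local instance] Classical.propDecidable

section Prelude

variable {α : Type*} {L : Type*}

/-- The cover relation within the subposet on the subset `s`. -/
def CovIn [PartialOrder α] (s : Set α) (a b : α) : Prop :=
  a ∈ s ∧ b ∈ s ∧ a < b ∧ ∀ c ∈ s, ¬(a < c ∧ c < b)

/-- `l` is a maximal chain of the subposet of `α` on the subset `s`:
a nonempty saturated chain starting at a minimal element of `s` and
ending at a maximal element of `s`. -/
def IsMaxChainIn [PartialOrder α] (s : Set α) (l : List α) : Prop :=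
  l ≠ [] ∧ (∀ x ∈ l, x ∈ s) ∧ l.Chain' (CovIn s) ∧
    (∀ x, l.head? = some x → ∀ c ∈ s, ¬c < x) ∧
    (∀ x, l.getLast? = some x → ∀ c ∈ s, ¬x < c)

/-- `l` is a maximal chain of the poset `α`. -/
def IsMaximalChain [PartialOrder α] (l : List α) : Prop :=
  IsMaxChainIn Set.univ l

/-- The poset `α` has length `n`, i.e. its longest chains have `n + 1` elements. -/
def HasLength (α : Type*) [PartialOrder α] (n : ℕ) : Prop :=
  (∃ l : List α, l.Chain' (· < ·) ∧ l.length = n + 1) ∧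
    ∀ l : List α, l.Chain' (· < ·) → l.length ≤ n + 1

/-- `r` is a rank function for the poset `α`; the existence of such a function says
exactly that `α` is semipure with rank function `r` (for every `x`, every maximal chain
of the lower order ideal `P_{≤ x}` has length `r x`, i.e. `r x + 1` elements). -/
def IsRankFunction [PartialOrder α] (r : α → ℕ) : Prop :=
  ∀ x : α, ∀ l : List α, IsMaxChainIn (Set.Iic x) l → l.length = r x + 1

/-- The label sequence of a chain `l` under the edge labeling `lab`. -/
def labelSeq (lab : α → α → L) (l : List α) : List L :=
  List.zipWith lab l l.tail

/-- `l` is a maximal (i.e. saturated) chain of the closed interval `[x, y]`. -/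
def IsMaxChainOfInterval [PartialOrder α] (x y : α) (l : List α) : Prop :=
  l.Chain' (· ⋖ ·) ∧ l.head? = some x ∧ l.getLast? = some y

/-- The EL-condition for the interval `[x, y]`: there is a unique maximal chain of
`[x, y]` with weakly increasing labels, and its label sequence strictly lexicographically
precedes the label sequence of any other maximal chain of `[x, y]`. -/
def ELCondition [PartialOrder α] [PartialOrder L] (lab : α → α → L) (x y : α) : Prop :=
  ∃ c : List α, IsMaxChainOfInterval x y c ∧ (labelSeq lab c).Chain' (· ≤ ·) ∧
    (∀ d : List α, IsMaxChainOfInterval x y d → (labelSeq lab d).Chain' (· ≤ ·) → d = c) ∧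
    ∀ d : List α, IsMaxChainOfInterval x y d → d ≠ c →
      List.Lex (· < ·) (labelSeq lab c) (labelSeq lab d)

/-- `lab` is an EL-labeling of the poset `α`. -/
def IsELLabeling [PartialOrder α] [PartialOrder L] (lab : α → α → L) : Prop :=
  ∀ x y : α, x ≤ y → ELCondition lab x y

/-- `lab` is a semi-EL-labeling of the poset `α` with minimum element: its restriction to
`[⊥, m]` is an EL-labeling for every maximal element `m`. -/
def IsSemiELLabeling [PartialOrder α] [OrderBot α] [PartialOrder L] (lab : α → α → L) : Prop :=
  ∀ m : α, IsMax m → ∀ x y : α, x ≤ y → y ≤ m → ELCondition lab x y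

/-- The underlying set of the Rees product of two (semipure) posets with
rank functions `rP`, `rQ`. -/
def Rees {α β : Type*} [PartialOrder α] [PartialOrder β] (rP : α → ℕ) (rQ : β → ℕ) : Type _ :=
  {x : α × β // rQ x.2 ≤ rP x.1}

/-- The Rees product order: `(p₁,q₁) ≤ (p₂,q₂)` iff `p₁ ≤ p₂`, `q₁ ≤ q₂` and the rank
increase in the first coordinate is at least the rank increase in the second coordinate. -/
instance Rees.instPartialOrder {α β : Type*} [PartialOrder α] [PartialOrder β]
    (rP : α → ℕ) (rQ : β → ℕ) : PartialOrder (Rees rP rQ) where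
  le x y := x.1.1 ≤ y.1.1 ∧ x.1.2 ≤ y.1.2 ∧ rQ y.1.2 + rP x.1.1 ≤ rP y.1.1 + rQ x.1.2
  le_refl x := ⟨le_rfl, le_rfl, by omega⟩
  le_trans x y z h₁ h₂ := ⟨h₁.1.trans h₂.1, h₁.2.1.trans h₂.2.1, by
    have := h₁.2.2; have := h₂.2.2; omega⟩
  le_antisymm x y h₁ h₂ := Subtype.ext
    (Prod.ext (le_antisymm h₁.1 h₂.1) (le_antisymm h₁.2.1 h₂.2.1))

/-- First (`P₁`) component of an element of `(P₁ ∗ P₂)^`, as an element of `P̂₁`;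
the adjoined minimum goes to `0̂₁` and the adjoined maximum to `1̂₁`. -/
def reesFst {α β : Type*} [PartialOrder α] [PartialOrder β] {rP : α → ℕ} {rQ : β → ℕ}
    (a : WithBot (WithTop (Rees rP rQ))) : WithBot (WithTop α) :=
  WithBot.recBotCoe ⊥
    (fun b => WithTop.recTopCoe (⊤ : WithBot (WithTop α))
      (fun z => ((z.1.1 : WithTop α) : WithBot (WithTop α))) b) a

/-- Second (`P₂`) component of an element of `(P₁ ∗ P₂)^`; the adjoined minimum is
identified with `(0̂₁, 0̂₂)`, so its second component is `0̂₂ = ⊥`. -/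
def reesSnd {α β : Type*} [PartialOrder α] [PartialOrder β] [OrderBot β]
    {rP : α → ℕ} {rQ : β → ℕ} (a : WithBot (WithTop (Rees rP rQ))) : β :=
  WithBot.recBotCoe ⊥ (fun b => WithTop.recTopCoe (⊥ : β) (fun z => z.1.2) b) a

/-- The Rees-product edge labeling of `(P₁ ∗ P₂)^` by the poset `L₁ × (L₂ ⊎ {0̂_{L₂}})`
(the product order, a new minimum `⊥` adjoined to `L₂`): a cover `((x,k),(y,l))` is
labeled `(λ₁(x,y), λ₂(k,l))` if `k < l`, and `(λ₁(x,y), 0̂_{L₂})` if `k = l`; a cover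
`((x,k), 1̂)` of the top is labeled `(λ₁(x,1̂₁), 0̂_{L₂})`. -/
noncomputable def reesLab {α β L₁ L₂ : Type*} [PartialOrder α] [PartialOrder β] [OrderBot β]
    [PartialOrder L₂] (rP : α → ℕ) (rQ : β → ℕ)
    (lab₁ : WithBot (WithTop α) → WithBot (WithTop α) → L₁) (lab₂ : β → β → L₂)
    (a b : WithBot (WithTop (Rees rP rQ))) : L₁ × WithBot L₂ :=
  (lab₁ (reesFst a) (reesFst b),
    if reesSnd a < reesSnd b then ((lab₂ (reesSnd a) (reesSnd b) : L₂) : WithBot L₂) else ⊥)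

end Prelude

section Words

/-- `T_{t,n}`: the poset of sequences over `[t]` of length at most `n`,
ordered by the prefix order (a complete `t`-ary tree of height `n`, rooted at bottom). -/
def Ttn (t n : ℕ) : Type := {l : List (Fin t) // l.length ≤ n}

instance (t n : ℕ) : PartialOrder (Ttn t n) where
  le x y := x.1 <+: y.1
  le_refl x := List.prefix_refl x.1
  le_trans _ _ _ h₁ h₂ := List.IsPrefix.trans h₁ h₂
  le_antisymm _ _ h₁ h₂ := Subtype.ext (List.IsPrefix.eq_of_length h₁
    (le_antisymm (List.IsPrefix.length_le h₁) (List.IsPrefix.length_le h₂)))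

instance (t n : ℕ) : OrderBot (Ttn t n) where
  bot := ⟨[], by simp⟩
  bot_le x := show [] <+: x.1 from List.nil_prefix

/-- The rank function of `T_{t,n}` (its length as a sequence). -/
def rankT (t n : ℕ) (q : Ttn t n) : ℕ := q.1.length

/-- A maximal chain is ascent free (w.r.t. the labeling `lab`) if no two consecutive
labels `a`, `b` on the chain satisfy `a ≤ b`. -/
def AscentFree {α L : Type*} [Preorder L] (lab : α → α → L) (l : List α) : Prop :=
  (labelSeq lab l).Chain' (fun a b => ¬a ≤ b)

/-- The number of ascents of the word `w = w₁ ⋯ w_m` over the poset `L`: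
indices `i ∈ [m-1]` with `w_i ≤ w_{i+1}`. -/
noncomputable def ascF {L : Type*} [Preorder L] {m : ℕ} (w : Fin m → L) : ℕ :=
  (Finset.univ.filter fun i : Fin (m - 1) =>
      w ⟨(i : ℕ), by have := i.2; omega⟩ ≤ w ⟨(i : ℕ) + 1, by have := i.2; omega⟩).card

/-- The word `w = w₁ ⋯ w_m` over the poset `L` has no double ascent
(no `i` with `w_i ≤ w_{i+1} ≤ w_{i+2}`). -/
def NDAF {L : Type*} [Preorder L] {m : ℕ} (w : Fin m → L) : Prop :=
  ∀ i : ℕ, ∀ h : i + 2 < m,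
    ¬(w ⟨i, by omega⟩ ≤ w ⟨i + 1, by omega⟩ ∧ w ⟨i + 1, by omega⟩ ≤ w ⟨i + 2, h⟩)

end Words

section Counting

/-- The up/stay indicator sequence: starts with `b`, then `D`, then `false`. -/
def stp {t n : ℕ} (b : Bool) (D : Fin n → Option (Fin t)) : ℕ → Bool
  | 0 => b
  | j + 1 => if h : j < n then (D ⟨j, h⟩).isSome else false

/-- The ascent-free condition in terms of the ascent pattern `a`. -/
def KC {t n : ℕ} (a : ℕ → Prop) (b : Bool) (D : Fin n → Option (Fin t)) : Prop :=
  ∀ j, j ≤ n → a j → stp b D j = true ∧ stp b D (j + 1) = false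

noncomputable def CC (t : ℕ) (a : ℕ → Prop) (n : ℕ) (b : Bool) : ℕ :=
  Fintype.card {D : Fin n → Option (Fin t) // KC a b D}

lemma stp_cons {t n : ℕ} (b : Bool) (d : Option (Fin t)) (D : Fin n → Option (Fin t)) (j : ℕ) :
    stp b (Fin.cons d D : Fin (n + 1) → Option (Fin t)) (j + 1) = stp d.isSome D j := by
  cases j with
  | zero => simp [stp]
  | succ j =>
    simp only [stp, Nat.add_lt_add_iff_right]
    split_ifs with h
    · rw [show (⟨j + 1, by omega⟩ : Fin (n + 1)) = Fin.succ ⟨j, h⟩ from rfl, Fin.cons_succ]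
    · rfl

lemma KC_cons {t n : ℕ} (a : ℕ → Prop) (b : Bool) (d : Option (Fin t))
    (D : Fin n → Option (Fin t)) :
    KC a b (Fin.cons d D : Fin (n + 1) → Option (Fin t)) ↔
      (a 0 → b = true ∧ d.isSome = false) ∧ KC (fun j => a (j + 1)) d.isSome D := by
  constructor
  · intro h
    refine ⟨fun h0 => ?_, fun j hj haj => ?_⟩
    · have := h 0 (by omega) h0
      rwa [stp_cons] at this
    · have := h (j + 1) (by omega) haj
      rwa [stp_cons, stp_cons] at this
  · rintro ⟨h1, h2⟩ j hj haj
    cases j with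
    | zero => rw [stp_cons]; exact h1 haj
    | succ j => rw [stp_cons, stp_cons]; exact h2 j (by omega) haj

lemma CC_zero (t : ℕ) (a : ℕ → Prop) (b : Bool) :
    CC t a 0 b = if a 0 → b = true then 1 else 0 := by
  unfold CC
  have : ∀ D : Fin 0 → Option (Fin t), KC a b D ↔ (a 0 → b = true) := by
    intro D
    constructor
    · intro h h0
      exact (h 0 le_rfl h0).1
    · intro h j hj haj
      obtain rfl : j = 0 := by omega
      exact ⟨h haj, by simp [stp]⟩
  rw [Fintype.card_subtype, Finset.card_filter]
  simp only [this]
  split_ifs with h <;> simp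

lemma CC_succ (t : ℕ) (a : ℕ → Prop) (n : ℕ) (b : Bool) :
    CC t a (n + 1) b = (if a 0 → b = true then CC t (fun j => a (j + 1)) n false else 0) +
      t * (if a 0 then 0 else CC t (fun j => a (j + 1)) n true) := by
  have key : CC t a (n + 1) b = ∑ d : Option (Fin t),
      (if a 0 → b = true ∧ d.isSome = false then CC t (fun j => a (j + 1)) n d.isSome else 0) := by
    unfold CC
    rw [Fintype.card_subtype, Finset.card_filter,
      ← (Fin.consEquiv (fun _ : Fin (n + 1) => Option (Fin t))).sum_comp,
      Fintype.sum_prod_type]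
    refine Finset.sum_congr rfl fun d _ => ?_
    have hcons : ∀ D : Fin n → Option (Fin t),
        (Fin.consEquiv (fun _ : Fin (n + 1) => Option (Fin t))) (d, D) =
          (Fin.cons d D : Fin (n + 1) → Option (Fin t)) := fun _ => rfl
    simp only [hcons, KC_cons]
    split_ifs with h
    · rw [Fintype.card_subtype, Finset.card_filter]
      refine Finset.sum_congr rfl fun D _ => ?_
      by_cases h2 : KC (fun j => a (j + 1)) d.isSome D
      · rw [if_pos h2, if_pos ⟨h, h2⟩]
      · rw [if_neg h2, if_neg (fun h3 => h2 h3.2)]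
    · refine Finset.sum_eq_zero fun D _ => ?_
      rw [if_neg (fun h3 => h h3.1)]
  rw [key, Fintype.sum_option]
  simp

def GoodP (a : ℕ → Prop) (n : ℕ) : Prop :=
  0 < n ∧ (∀ i, i + 1 < n → ¬ (a i ∧ a (i + 1))) ∧ ¬ a 0 ∧ ¬ a (n - 1)

lemma CC_main (t : ℕ) : ∀ n, ∀ a : ℕ → Prop, a n →
    CC t a n false =
      (if GoodP a n then
        t ^ (Nat.count a n + 1) * (1 + t) ^ (n - 1 - 2 * Nat.count a n) else 0) ∧
    (GoodP a n →
      2 * Nat.count a n + 1 ≤ n) := by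
  intro n
  induction n using Nat.strong_induction_on with
  | _ n ih =>
  intro a han
  match n with
  | 0 => simp [CC_zero, han, GoodP]
  | 1 =>
    by_cases h0 : a 0
    · simp [CC_succ, h0, GoodP]
    · simp [CC_succ, CC_zero, h0, han, Nat.count_succ, GoodP]
  | n + 2 =>
    by_cases h0 : a 0
    · simp [CC_succ, h0, GoodP]
    by_cases h1 : a 1
    · obtain ⟨e, ee⟩ := ih n (by omega) (fun j => a (j + 2)) (by simpa using han)
      have hc : CC t a (n + 2) false = t * CC t (fun j => a (j + 2)) n false := by
        rw [CC_succ]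
        simp [h0, CC_succ, h1]
      have hcount : Nat.count a (n + 2) = Nat.count (fun j => a (j + 2)) n + 1 := by
        rw [Nat.count_succ', Nat.count_succ']
        simp [h0, h1]
      have hg : GoodP a (n + 2) ↔ GoodP (fun j => a (j + 2)) n := by
        constructor
        · rintro ⟨-, h, -, h'⟩
          have hn : 0 < n := by
            rcases Nat.eq_zero_or_pos n with rfl | h
            · exact absurd h1 h'
            · exact h
          refine ⟨hn, fun i hi => ?_, fun h2 => h 1 (by omega) ⟨h1, h2⟩, ?_⟩
          · exact h (i + 2) (by omega)
          · show ¬ a (n - 1 + 2)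
            rwa [show n - 1 + 2 = n + 2 - 1 by omega]
        · rintro ⟨hn, h, h2, h'⟩
          refine ⟨by omega, fun i hi => ?_, h0, ?_⟩
          · match i with
            | 0 => exact fun h => h0 h.1
            | 1 => exact fun h => h2 h.2
            | i + 2 => exact h i (by omega)
          · rwa [show n + 2 - 1 = n - 1 + 2 by omega]
      rw [hg, hcount, hc, e]
      refine ⟨?_, fun h => ?_⟩
      · split_ifs with h
        · rw [show n + 2 - 1 - 2 * (Nat.count (fun j => a (j + 2)) n + 1) =
            n - 1 - 2 * (Nat.count (fun j => a (j + 2)) n) by omega]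
          ring
        · rfl
      · have := ee h
        omega
    · obtain ⟨e, ee⟩ := ih (n + 1) (by omega) (fun j => a (j + 1)) (by simpa using han)
      have hc : CC t a (n + 2) false = (1 + t) * CC t (fun j => a (j + 1)) (n + 1) false := by
        have : CC t (fun j => a (j + 1)) (n + 1) true = CC t (fun j => a (j + 1)) (n + 1) false := by
          rw [CC_succ, CC_succ]
          simp [h1]
        rw [CC_succ, this]
        simp [h0]
        ring
      have hcount : Nat.count a (n + 2) = Nat.count (fun j => a (j + 1)) (n + 1) := by
        rw [Nat.count_succ']
        simp [h0]
      have hg : GoodP a (n + 2) ↔ GoodP (fun j => a (j + 1)) (n + 1) := by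
        constructor
        · rintro ⟨-, h, -, h'⟩
          exact ⟨by omega, fun i hi => h (i + 1) (by omega), h1, h'⟩
        · rintro ⟨hn, h, h2, h'⟩
          refine ⟨by omega, fun i hi => ?_, h0, h'⟩
          match i with
          | 0 => exact fun h => h0 h.1
          | i + 1 => exact h i (by omega)
      rw [hg, hcount, hc, e]
      refine ⟨?_, fun h => ?_⟩
      · split_ifs with h
        · have := ee h
          rw [show n + 2 - 1 - 2 * (Nat.count (fun j => a (j + 1)) (n + 1)) =
            (n + 1 - 1 - 2 * (Nat.count (fun j => a (j + 1)) (n + 1))) + 1 by omega]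
          ring
        · rfl
      · have := ee h
        omega

end Counting

section Chains

lemma covIn_univ {X : Type*} [PartialOrder X] : CovIn (Set.univ : Set X) = (· ⋖ ·) := by
  funext a b
  simp only [CovIn, CovBy, Set.mem_univ, true_and, eq_iff_iff]
  refine and_congr_right fun _ => ⟨fun h c h1 h2 => h c trivial ⟨h1, h2⟩, fun h c _ h1 => h h1.1 h1.2⟩

lemma isMaximalChain_iff {X : Type*} [PartialOrder X] (l : List X) :
    IsMaximalChain l ↔ l ≠ [] ∧ l.IsChain (· ⋖ ·) ∧ (∀ x, l.head? = some x → IsMin x) ∧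
      (∀ x, l.getLast? = some x → IsMax x) := by
  unfold IsMaximalChain IsMaxChainIn
  rw [covIn_univ]
  simp only [Set.mem_univ, implies_true, true_and, isMin_iff_forall_not_lt,
    isMax_iff_forall_not_lt, forall_const]
  rfl

lemma isMax_withBot_coe {X : Type*} [PartialOrder X] (a : X) :
    IsMax (a : WithBot X) ↔ IsMax a := by
  simp [isMax_iff_forall_not_lt]

lemma isMin_withTop_coe {X : Type*} [PartialOrder X] (a : X) :
    IsMin (a : WithTop X) ↔ IsMin a := by
  simp [isMin_iff_forall_not_lt]

lemma isMaximalChain_withBot {X : Type*} [PartialOrder X] (m : List X) (hm : m ≠ []) :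
    IsMaximalChain ((⊥ : WithBot X) :: m.map (WithBot.some : X → WithBot X)) ↔ IsMaximalChain m := by
  rw [isMaximalChain_iff, isMaximalChain_iff]
  obtain ⟨a, m, rfl⟩ := List.exists_cons_of_ne_nil hm
  simp only [List.map_cons, List.isChain_cons_cons, WithBot.bot_covBy_coe, List.head?_cons,
    List.getLast?_cons_cons, ne_eq, reduceCtorEq, not_false_eq_true, true_and, Option.some.injEq,
    forall_eq']
  rw [← List.map_cons (f := (WithBot.some : X → WithBot X)), List.isChain_map, List.getLast?_map]
  simp only [WithBot.coe_covBy_coe, isMin_bot, true_and]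
  rw [List.getLast?_eq_some_getLast (by simp)]
  simp only [Option.map_some, Option.some.injEq, forall_eq', isMax_withBot_coe]
  tauto

lemma exists_of_isMaximalChain_withBot {X : Type*} [PartialOrder X] (l : List (WithBot X))
    (hl : IsMaximalChain l) : ∃ m : List X, l = ⊥ :: m.map (WithBot.some : X → WithBot X) := by
  rw [isMaximalChain_iff] at hl
  obtain ⟨h0, h1, h2, -⟩ := hl
  obtain ⟨a, m, rfl⟩ := List.exists_cons_of_ne_nil h0
  obtain rfl : a = ⊥ := by simpa using h2 a rfl
  have h3 : (⊥ :: m : List (WithBot X)).Pairwise (· < ·) :=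
    List.isChain_iff_pairwise.1 (h1.imp fun _ _ h => h.lt)
  rw [List.pairwise_cons] at h3
  have : ∀ x ∈ m, x ≠ ⊥ := fun x hx =>
    (h3.1 x hx).ne'
  lift m to List X using this
  exact ⟨m, rfl⟩

lemma isMaximalChain_withTop {X : Type*} [PartialOrder X] (m : List X) (hm : m ≠ []) :
    IsMaximalChain (m.map (WithTop.some : X → WithTop X) ++ [⊤]) ↔ IsMaximalChain m := by
  rw [isMaximalChain_iff, isMaximalChain_iff]
  have e : m.head? = some (m.head hm) := List.head?_eq_some_head hm
  simp only [List.isChain_append, List.isChain_map, List.getLast?_map, List.head?_append,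
    List.head?_map, e, List.getLast?_eq_some_getLast hm, WithTop.coe_covBy_coe]
  simp [hm, isMin_withTop_coe, -covBy_top_iff]
  tauto

lemma exists_of_isMaximalChain_withTop {X : Type*} [PartialOrder X] (l : List (WithTop X))
    (hl : IsMaximalChain l) : ∃ m : List X, l = m.map (WithTop.some : X → WithTop X) ++ [⊤] := by
  rw [isMaximalChain_iff] at hl
  obtain ⟨h0, h1, -, h2⟩ := hl
  obtain ⟨m, a, rfl⟩ := List.eq_nil_or_concat' l |>.resolve_left h0
  obtain rfl : a = ⊤ := by simpa using h2 a (by simp)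
  have h3 : (m ++ [⊤] : List (WithTop X)).Pairwise (· < ·) :=
    List.isChain_iff_pairwise.1 (h1.imp fun _ _ h => h.lt)
  rw [List.pairwise_append] at h3
  have : ∀ x ∈ m, x ≠ ⊤ := fun x hx =>
    (h3.2.2 x hx ⊤ (by simp)).ne
  lift m to List X using this
  exact ⟨m, rfl⟩

/-- Maximal chains with `n + 1` elements as functions. -/
def MC {X : Type*} [PartialOrder X] {n : ℕ} (g : Fin (n + 1) → X) : Prop :=
  (∀ i : Fin n, g i.castSucc ⋖ g i.succ) ∧ IsMin (g 0) ∧ IsMax (g (Fin.last n))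

lemma isMaximalChain_ofFn {X : Type*} [PartialOrder X] {n : ℕ} (g : Fin (n + 1) → X) :
    IsMaximalChain (List.ofFn g) ↔ MC g := by
  rw [isMaximalChain_iff, List.isChain_ofFn, List.head?_eq_some_head (by simp),
    List.getLast?_eq_some_getLast (by simp)]
  simp only [Option.some.injEq, forall_eq', List.head_ofFn, List.getLast_ofFn]
  unfold MC
  constructor
  · rintro ⟨-, h, h', h''⟩
    exact ⟨fun i => h i.1 (by omega), h', h''⟩
  · rintro ⟨h, h', h''⟩
    exact ⟨by simp, fun i hi => h ⟨i, by omega⟩, h', h''⟩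

/-- The chain of `WithBot X` attached to a function. -/
def psiB {X : Type*} {n : ℕ} (g : Fin (n + 1) → X) : List (WithBot X) :=
  ⊥ :: (List.ofFn g).map (WithBot.some : X → WithBot X)

/-- The chain of `X̂` attached to a function. -/
def psiH {X : Type*} {n : ℕ} (g : Fin (n + 1) → X) : List (WithBot (WithTop X)) :=
  ⊥ :: ((List.ofFn g).map (WithTop.some : X → WithTop X) ++ [⊤]).map
    (WithBot.some : WithTop X → WithBot (WithTop X))

lemma card_psiB {X : Type*} [PartialOrder X] (n : ℕ) (Q : List (WithBot X) → Prop)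
    (hQ : ∀ l, Q l → l.length = n + 2) :
    Nat.card {l : List (WithBot X) // IsMaximalChain l ∧ Q l} =
      Nat.card {g : Fin (n + 1) → X // MC g ∧ Q (psiB g)} := by
  symm
  have key : ∀ g : Fin (n + 1) → X, IsMaximalChain (psiB g) ↔ MC g := fun g => by
    unfold psiB
    rw [isMaximalChain_withBot _ (by simp), isMaximalChain_ofFn]
  refine Nat.card_eq_of_bijective
    (fun g => ⟨psiB g.1, (key g.1).2 g.2.1, g.2.2⟩) ⟨?_, ?_⟩
  · rintro ⟨g, hg⟩ ⟨g', hg'⟩ h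
    simp only [Subtype.mk.injEq, psiB, List.cons.injEq, true_and] at h
    have := List.map_injective_iff.2 (fun a b h => WithBot.coe_injective h) h
    exact Subtype.ext (List.ofFn_injective this)
  · rintro ⟨l, hl, hq⟩
    obtain ⟨m, rfl⟩ := exists_of_isMaximalChain_withBot l hl
    have hlen := hQ _ hq
    obtain ⟨g, rfl⟩ : ∃ g : Fin (n + 1) → X, m = List.ofFn g := by
      have h2 : m.length = n + 1 := by simpa using hlen
      refine ⟨fun i => m.get (i.cast h2.symm), ?_⟩
      exact List.ext_getElem (by simp [h2]) (fun i _ _ => by rw [List.getElem_ofFn]; simp)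
    exact ⟨⟨g, (key g).1 hl, hq⟩, rfl⟩

lemma card_psiH {X : Type*} [PartialOrder X] (n : ℕ) (Q : List (WithBot (WithTop X)) → Prop)
    (hQ : ∀ l, Q l → l.length = n + 3) :
    Nat.card {l : List (WithBot (WithTop X)) // IsMaximalChain l ∧ Q l} =
      Nat.card {g : Fin (n + 1) → X // MC g ∧ Q (psiH g)} := by
  symm
  have key : ∀ g : Fin (n + 1) → X, IsMaximalChain (psiH g) ↔ MC g := fun g => by
    unfold psiH
    rw [isMaximalChain_withBot _ (by simp), isMaximalChain_withTop _ (by simp),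
      isMaximalChain_ofFn]
  refine Nat.card_eq_of_bijective
    (fun g => ⟨psiH g.1, (key g.1).2 g.2.1, g.2.2⟩) ⟨?_, ?_⟩
  · rintro ⟨g, hg⟩ ⟨g', hg'⟩ h
    simp only [Subtype.mk.injEq, psiH, List.cons.injEq, true_and] at h
    have := List.map_injective_iff.2 (fun a b h => WithBot.coe_injective h) h
    have := List.append_cancel_right this
    have := List.map_injective_iff.2 (fun a b h => WithTop.coe_injective h) this
    exact Subtype.ext (List.ofFn_injective this)
  · rintro ⟨l, hl, hq⟩
    obtain ⟨m, rfl⟩ := exists_of_isMaximalChain_withBot l hl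
    have hlen := hQ _ hq
    have hm : m ≠ [] := by rintro rfl; simp at hlen
    rw [isMaximalChain_withBot _ hm] at hl
    obtain ⟨m, rfl⟩ := exists_of_isMaximalChain_withTop m hl
    obtain ⟨g, rfl⟩ : ∃ g : Fin (n + 1) → X, m = List.ofFn g := by
      have h2 : m.length = n + 1 := by simpa using hlen
      refine ⟨fun i => m.get (i.cast h2.symm), ?_⟩
      exact List.ext_getElem (by simp [h2]) (fun i _ _ => by rw [List.getElem_ofFn]; simp)
    refine ⟨⟨g, ?_, hq⟩, rfl⟩
    rwa [isMaximalChain_withTop _ (by simp), isMaximalChain_ofFn] at hl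

lemma covIn_Iic {X : Type*} [PartialOrder X] (x a b : X) :
    CovIn (Set.Iic x) a b ↔ a ⋖ b ∧ b ≤ x := by
  constructor
  · rintro ⟨h1, h2, h3, h4⟩
    exact ⟨⟨h3, fun c h5 h6 => h4 c (h6.le.trans h2) ⟨h5, h6⟩⟩, h2⟩
  · rintro ⟨h, h'⟩
    exact ⟨h.le.trans h', h', h.lt, fun c _ hc => h.2 hc.1 hc.2⟩

/-- saturated chain from a minimal element to `x`. -/
def SatTo {X : Type*} [PartialOrder X] (x : X) (l : List X) : Prop :=
  l.IsChain (· ⋖ ·) ∧ (∀ a, l.head? = some a → IsMin a) ∧ l.getLast? = some x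

lemma SatTo.le {X : Type*} [PartialOrder X] {x : X} {l : List X} (h : SatTo x l) :
    ∀ y ∈ l, y ≤ x := by
  obtain ⟨h1, h2, h3⟩ := h
  have hp : l.Pairwise (· ≤ ·) := List.isChain_iff_pairwise.1 (h1.imp fun _ _ h => h.le)
  obtain ⟨m, rfl⟩ := List.getLast?_eq_some_iff.1 h3
  rw [List.pairwise_append] at hp
  intro y hy
  rcases List.mem_append.1 hy with h | h
  · exact hp.2.2 y h x (by simp)
  · simp at h; exact h.le

lemma SatTo.isMaxChainIn {X : Type*} [PartialOrder X] {x : X} {l : List X} (h : SatTo x l) :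
    IsMaxChainIn (Set.Iic x) l := by
  have hle := h.le
  obtain ⟨h1, h2, h3⟩ := h
  refine ⟨by rintro rfl; simp at h3, hle, ?_, ?_, ?_⟩
  · change l.IsChain _
    rw [List.isChain_iff_getElem] at h1 ⊢
    intro i hi
    rw [covIn_Iic]
    exact ⟨h1 i hi, hle _ (List.getElem_mem _)⟩
  · intro y hy c _ hc
    exact (h2 y hy).not_lt hc
  · intro y hy c hc hlt
    rw [h3] at hy
    obtain rfl := Option.some.inj hy
    exact absurd hlt (not_lt_of_ge hc)

lemma SatTo.snoc {X : Type*} [PartialOrder X] {x y : X} {l : List X} (h : SatTo x l)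
    (hxy : x ⋖ y) : SatTo y (l ++ [y]) := by
  obtain ⟨h1, h2, h3⟩ := h
  refine ⟨?_, ?_, by simp⟩
  · rw [List.isChain_append]
    refine ⟨h1, by simp, ?_⟩
    intro a ha b hb
    rw [h3] at ha
    simp at ha hb
    rw [← ha, ← hb]
    exact hxy
  · intro a ha
    apply h2
    cases l with
    | nil => simp at h3
    | cons => simpa using ha

lemma exists_satTo {X : Type*} [PartialOrder X] [Finite X] (x : X) : ∃ l, SatTo x l := by
  induction x using WellFoundedLT.induction with
  | _ x ih =>
  by_cases hx : IsMin x
  · exact ⟨[x], by simp, by simpa using hx, by simp⟩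
  · obtain ⟨y, hy⟩ := not_isMin_iff.1 hx
    obtain ⟨z, hz1, hz2⟩ := exists_le_covBy_of_lt hy
    obtain ⟨l, hl⟩ := ih z hz2.lt
    exact ⟨_, hl.snoc hz2⟩

lemma rank_min {X : Type*} [PartialOrder X] {r : X → ℕ} (hr : IsRankFunction r) {x : X}
    (hx : IsMin x) : r x = 0 := by
  have := hr x [x] (SatTo.isMaxChainIn ⟨by simp, by simpa using hx, by simp⟩)
  simpa using this

lemma rank_cov {X : Type*} [PartialOrder X] [Finite X] {r : X → ℕ} (hr : IsRankFunction r)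
    {x y : X} (hxy : x ⋖ y) : r y = r x + 1 := by
  obtain ⟨l, hl⟩ := exists_satTo x
  have h1 := hr x l hl.isMaxChainIn
  have h2 := hr y _ (hl.snoc hxy).isMaxChainIn
  simp at h2
  omega

lemma rank_mono {X : Type*} [PartialOrder X] [Finite X] {r : X → ℕ} (hr : IsRankFunction r) :
    ∀ {x y : X}, x ≤ y → r x ≤ r y := by
  intro x y
  induction x using WellFoundedGT.induction with
  | _ x ih =>
  intro h
  rcases h.eq_or_lt with rfl | h
  · rfl
  · obtain ⟨z, hz1, hz2⟩ := exists_covBy_le_of_lt h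
    have := rank_cov hr hz1
    have := ih z hz1.lt hz2
    omega

lemma exists_cov_min {X : Type*} [PartialOrder X] [Finite X] {x : X} (hx : ¬ IsMin x) :
    ∃ y, y ⋖ x := by
  obtain ⟨y, hy⟩ := not_isMin_iff.1 hx
  obtain ⟨z, hz1, hz2⟩ := exists_le_covBy_of_lt hy
  exact ⟨z, hz2⟩

end Chains

section ReesChains

variable {α L : Type*} [PartialOrder α] {t n : ℕ} {rP : α → ℕ}

lemma rees_eq {x y : Rees rP (rankT t n)} (h : x ≤ y) (h' : x.1.1 = y.1.1) : x = y := by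
  obtain ⟨h1, h2, h3⟩ := h
  apply Subtype.ext
  apply Prod.ext h'
  apply Subtype.ext
  have h2' : x.1.2.1 <+: y.1.2.1 := h2
  apply h2'.eq_of_length
  have := h2'.length_le
  rw [h'] at h3
  unfold rankT at h3
  omega

lemma rees_lt_fst {x y : Rees rP (rankT t n)} (h : x < y) : x.1.1 < y.1.1 :=
  lt_of_le_of_ne h.le.1 fun h' => h.ne (rees_eq h.le h')

lemma rees_cov [Finite α] (hrP : IsRankFunction rP) {x y : Rees rP (rankT t n)} :
    x ⋖ y ↔ x.1.1 ⋖ y.1.1 ∧ ∃ d : Option (Fin t), y.1.2.1 = x.1.2.1 ++ d.toList := by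
  constructor
  · intro h
    have hlt := rees_lt_fst h.lt
    obtain ⟨h1, h2, h3⟩ := h.le
    have h2' : x.1.2.1 <+: y.1.2.1 := h2
    have hlen := h2'.length_le
    unfold rankT at h3
    obtain ⟨c, hc1, hc2⟩ := exists_covBy_le_of_lt hlt
    have hrc := rank_cov hrP hc1
    have hrc2 := rank_mono hrP hc2
    have hx2 : x.1.2.1.length ≤ rP x.1.1 := x.2
    have hcy : c = y.1.1 := by
      by_contra hne
      have hcy : c < y.1.1 := lt_of_le_of_ne hc2 hne
      let z : Rees rP (rankT t n) := ⟨(c, ⟨y.1.2.1.take (x.1.2.1.length + 1),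
        by have := y.1.2.2; simp; omega⟩), by
          simp only [rankT, List.length_take]; omega⟩
      have hxz : x ≤ z := ⟨hc1.le, by
        change x.1.2.1 <+: y.1.2.1.take (x.1.2.1.length + 1)
        rw [List.prefix_take_iff]
        exact ⟨h2', by omega⟩, by
          change (y.1.2.1.take (x.1.2.1.length + 1)).length + rP x.1.1 ≤ rP c + x.1.2.1.length
          simp only [List.length_take]; omega⟩
      have hzy : z ≤ y := ⟨hc2, List.take_prefix _ _, by
          change y.1.2.1.length + rP c ≤ rP y.1.1 + (y.1.2.1.take (x.1.2.1.length + 1)).length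
          simp only [List.length_take]; omega⟩
      refine h.2 (lt_of_le_of_ne hxz ?_) (lt_of_le_of_ne hzy ?_)
      · rintro e
        exact hc1.lt.ne (congrArg (fun z => z.1.1) e)
      · rintro e
        exact hcy.ne (congrArg (fun z => z.1.1) e)
    subst hcy
    refine ⟨hc1, ?_⟩
    obtain ⟨s, hs⟩ := h2'
    rw [← hs, List.length_append] at h3
    match s, hs with
    | [], hs => exact ⟨none, by simpa using hs.symm⟩
    | [a], hs => exact ⟨some a, by simpa using hs.symm⟩
    | a :: b :: s, hs => simp at h3; omega
  · rintro ⟨h1, d, hd⟩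
    have hr := rank_cov hrP h1
    have hle : x ≤ y := ⟨h1.le, by change x.1.2.1 <+: y.1.2.1; rw [hd]; simp, by
      unfold rankT
      rw [hd, List.length_append]
      have : d.toList.length ≤ 1 := by cases d <;> simp
      omega⟩
    refine ⟨lt_of_le_of_ne hle fun e => h1.lt.ne (congrArg (fun z => z.1.1) e), ?_⟩
    intro z h2 h3
    exact h1.2 (rees_lt_fst h2) (rees_lt_fst h3)

lemma rees_isMin [Finite α] (hrP : IsRankFunction rP) {x : Rees rP (rankT t n)} :
    IsMin x ↔ IsMin x.1.1 ∧ x.1.2.1 = [] := by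
  have hx2 : x.1.2.1.length ≤ rP x.1.1 := x.2
  constructor
  · intro h
    have hm : IsMin x.1.1 := by
      by_contra hn
      obtain ⟨y, hy⟩ := exists_cov_min hn
      have hr := rank_cov hrP hy
      let z : Rees rP (rankT t n) := ⟨(y, ⟨x.1.2.1.dropLast,
        by have := x.1.2.2; simp; omega⟩), by
          simp only [rankT, List.length_dropLast]; omega⟩
      have hzx : z ≤ x := ⟨hy.le, List.dropLast_prefix _, by
        change x.1.2.1.length + rP y ≤ rP x.1.1 + x.1.2.1.dropLast.length
        simp only [List.length_dropLast]; omega⟩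
      exact absurd (h hzx).1 (not_le_of_gt hy.lt)
    refine ⟨hm, ?_⟩
    have := rank_min hrP hm
    exact List.eq_nil_of_length_eq_zero (by omega)
  · rintro ⟨h1, h2⟩ z hz
    exact (rees_eq hz (h1.eq_of_le hz.1)).ge

lemma rees_isMax [Finite α] [OrderTop α] (hrP : IsRankFunction rP) {x : Rees rP (rankT t n)} :
    IsMax x ↔ x.1.1 = ⊤ := by
  constructor
  · intro h
    let z : Rees rP (rankT t n) := ⟨(⊤, x.1.2), x.2.trans (rank_mono hrP le_top)⟩
    have hxz : x ≤ z := ⟨le_top, le_rfl, by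
      have := rank_mono hrP (le_top (a := x.1.1))
      change rankT t n x.1.2 + rP x.1.1 ≤ rP ⊤ + rankT t n x.1.2
      omega⟩
    exact top_le_iff.1 (h hxz).1
  · intro h z hz
    refine (rees_eq hz ?_).ge
    have := hz.1
    rw [h] at this ⊢
    exact (top_le_iff.1 this).symm

/-- The `P`-component. -/
def thF (g : Fin (n + 1) → Rees rP (rankT t n)) : Fin (n + 1) → α := fun i => (g i).1.1

/-- The step data. -/
def thD (g : Fin (n + 1) → Rees rP (rankT t n)) : Fin n → Option (Fin t) :=
  fun i => (g i.succ).1.2.1[(g i.castSucc).1.2.1.length]?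

lemma mc_rees [Finite α] [OrderTop α] (hrP : IsRankFunction rP)
    (g : Fin (n + 1) → Rees rP (rankT t n)) :
    MC g ↔ MC (thF g) ∧ (g 0).1.2.1 = [] ∧
      ∀ i : Fin n, (g i.succ).1.2.1 = (g i.castSucc).1.2.1 ++ (thD g i).toList := by
  have key : ∀ (q q' : List (Fin t)), (∃ d : Option (Fin t), q' = q ++ d.toList) ↔
      q' = q ++ (q'[q.length]?).toList := by
    intro q q'
    constructor
    · rintro ⟨d, rfl⟩
      cases d <;> simp
    · intro h
      exact ⟨_, h⟩
  unfold MC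
  simp only [rees_cov hrP, rees_isMin hrP, rees_isMax hrP, isMax_iff_eq_top, key, thF, thD]
  rw [forall_and]
  tauto

/-- The accumulated word. -/
def qD (D : Fin n → Option (Fin t)) : ℕ → List (Fin t)
  | 0 => []
  | i + 1 => qD D i ++ (if h : i < n then (D ⟨i, h⟩).toList else [])

lemma qD_length (D : Fin n → Option (Fin t)) (i : ℕ) : (qD D i).length ≤ i := by
  induction i with
  | zero => simp [qD]
  | succ i ih =>
    simp only [qD, List.length_append]
    have : (if h : i < n then (D ⟨i, h⟩).toList else []).length ≤ 1 := by
      split_ifs with h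
      · cases D ⟨i, h⟩ <;> simp
      · simp
    omega

lemma qD_succ (D : Fin n → Option (Fin t)) (i : Fin n) :
    qD D (i.succ : Fin (n + 1)).1 = qD D i.castSucc.1 ++ (D i).toList := by
  simp [qD]

lemma mc_rank [Finite α] (hrP : IsRankFunction rP) {F : Fin (n + 1) → α} (hF : MC F)
    (i : Fin (n + 1)) : rP (F i) = i := by
  induction i using Fin.induction with
  | zero => simpa using rank_min hrP hF.2.1
  | succ i ih => rw [rank_cov hrP (hF.1 i), ih]; simp

lemma th_injective [Finite α] [OrderTop α] (hrP : IsRankFunction rP)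
    {g g' : Fin (n + 1) → Rees rP (rankT t n)} (hg : MC g) (hg' : MC g')
    (hF : thF g = thF g') (hD : thD g = thD g') : g = g' := by
  rw [mc_rees hrP] at hg hg'
  funext i
  apply Subtype.ext
  apply Prod.ext (congrFun hF i)
  apply Subtype.ext
  induction i using Fin.induction with
  | zero => rw [hg.2.1, hg'.2.1]
  | succ i ih => rw [hg.2.2, hg'.2.2, ih, hD]

lemma th_surjective [Finite α] [OrderTop α] (hrP : IsRankFunction rP)
    {F : Fin (n + 1) → α} (hF : MC F) (D : Fin n → Option (Fin t)) :
    ∃ g : Fin (n + 1) → Rees rP (rankT t n), MC g ∧ thF g = F ∧ thD g = D := by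
  let g : Fin (n + 1) → Rees rP (rankT t n) := fun i =>
    ⟨(F i, ⟨qD D i.1, (qD_length D i.1).trans (by omega)⟩), by
      rw [mc_rank hrP hF]; exact qD_length D i.1⟩
  have h1 : thF g = F := rfl
  have h2 : thD g = D := by
    funext i
    change (qD D (i.succ : Fin (n + 1)).1)[(qD D i.castSucc.1).length]? = D i
    rw [qD_succ]
    cases D i <;> simp
  refine ⟨g, ?_, h1, h2⟩
  rw [mc_rees hrP, h1, h2]
  exact ⟨hF, rfl, qD_succ D⟩

/-- Extended indexing by natural numbers of the elements of `X̂` on the chain. -/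
def phat {X : Type*} {n : ℕ} (g : Fin (n + 1) → X) : ℕ → WithBot (WithTop X)
  | 0 => ⊥
  | i + 1 => if h : i < n + 1 then ((g ⟨i, h⟩ : WithTop X) : WithBot (WithTop X)) else
      ((⊤ : WithTop X) : WithBot (WithTop X))

/-- the extended label word. -/
def wx {n : ℕ} (lab : WithBot (WithTop α) → WithBot (WithTop α) → L) (F : Fin (n + 1) → α)
    (j : ℕ) : L := lab (phat F j) (phat F (j + 1))

lemma psiH_length {X : Type*} {n : ℕ} (g : Fin (n + 1) → X) : (psiH g).length = n + 3 := by
  simp only [psiH, List.length_cons, List.length_map, List.length_append, List.length_ofFn,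
    List.length_nil]

lemma psiB_length {X : Type*} {n : ℕ} (g : Fin (n + 1) → X) : (psiB g).length = n + 2 := by
  simp only [psiB, List.length_cons, List.length_map, List.length_ofFn]

lemma psiH_getElem {X : Type*} {n : ℕ} (g : Fin (n + 1) → X) (j : ℕ) (hj : j < (psiH g).length) :
    (psiH g)[j] = phat g j := by
  cases j with
  | zero => rfl
  | succ j =>
    simp only [psiH, List.getElem_cons_succ, List.getElem_map, List.getElem_append,
      List.length_map, List.length_ofFn, phat, List.getElem_ofFn, List.getElem_singleton]
    split_ifs <;> rfl

lemma psiB_getElem {X : Type*} {n : ℕ} (g : Fin (n + 1) → X) (j : ℕ) (hj : j < (psiB g).length) :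
    WithBot.map (fun x : X => (x : WithTop X)) (psiB g)[j] = phat g j := by
  cases j with
  | zero => rfl
  | succ j =>
    rw [psiB_length] at hj
    simp only [psiB, List.getElem_cons_succ, List.getElem_map, phat, List.getElem_ofFn]
    rw [dif_pos (by omega)]
    rfl

lemma labelSeq_getElem {X M : Type*} (lab : X → X → M) (l : List X) (j : ℕ)
    (hj : j < (labelSeq lab l).length) :
    (labelSeq lab l)[j] = lab (l[j]'(by simp [labelSeq] at hj; omega))
      (l[j + 1]'(by simp [labelSeq] at hj; omega)) := by
  simp [labelSeq]

lemma labelSeq_length {X M : Type*} (lab : X → X → M) (l : List X) :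
    (labelSeq lab l).length = l.length - 1 := by
  simp [labelSeq]

lemma labelSeq_psiB (lab : WithBot (WithTop α) → WithBot (WithTop α) → L)
    (F : Fin (n + 1) → α) :
    labelSeq (fun a b => lab (WithBot.map (fun x : α => (x : WithTop α)) a)
      (WithBot.map (fun x : α => (x : WithTop α)) b)) (psiB F) =
      List.ofFn (fun i : Fin (n + 1) => wx lab F i) := by
  apply List.ext_getElem
  · rw [labelSeq_length, psiB_length, List.length_ofFn]; rfl
  · intro j h1 h2
    rw [labelSeq_getElem, List.getElem_ofFn, psiB_getElem, psiB_getElem]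
    rfl

lemma reesFst_phat (g : Fin (n + 1) → Rees rP (rankT t n)) (j : ℕ) :
    reesFst (phat g j) = phat (thF g) j := by
  cases j with
  | zero => rfl
  | succ j =>
    simp only [phat]
    split_ifs <;> rfl

lemma reesSnd_phat [Finite α] [OrderTop α] (hrP : IsRankFunction rP)
    {g : Fin (n + 1) → Rees rP (rankT t n)} (hg : MC g) (j : ℕ) (hj : j ≤ n + 1) :
    reesSnd (phat g j) < reesSnd (phat g (j + 1)) ↔ stp false (thD g) j = true := by
  rw [mc_rees hrP] at hg
  obtain ⟨-, h0, h⟩ := hg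
  cases j with
  | zero =>
    have e : reesSnd (phat g (0 + 1)) = ⊥ := Subtype.ext h0
    rw [e]
    simp [stp]
  | succ j =>
    by_cases hjn : j < n
    · have e1 : reesSnd (phat g (j + 1)) = (g (Fin.castSucc ⟨j, hjn⟩)).1.2 := by
        simp only [phat]
        rw [dif_pos (by omega)]
        rfl
      have e2 : reesSnd (phat g (j + 1 + 1)) = (g (Fin.succ ⟨j, hjn⟩)).1.2 := by
        simp only [phat]
        rw [dif_pos (by omega)]
        rfl
      have h' := h ⟨j, hjn⟩
      rw [e1, e2]
      simp only [stp, dif_pos hjn]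
      cases hd : thD g ⟨j, hjn⟩ with
      | none =>
        rw [hd] at h'
        have : (g (Fin.succ ⟨j, hjn⟩)).1.2 = (g (Fin.castSucc ⟨j, hjn⟩)).1.2 :=
          Subtype.ext (by simpa using h')
        rw [this]
        simp only [lt_self_iff_false, Option.isSome_none, Bool.false_eq_true]
      | some a =>
        rw [hd] at h'
        simp only [Option.isSome_some, iff_true]
        refine lt_of_le_of_ne ?_ ?_
        · change List.IsPrefix _ _
          rw [h']
          simp
        · intro e
          rw [← e] at h'
          simp at h'
    · have e2 : reesSnd (phat g (j + 1 + 1)) = ⊥ := by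
        simp only [phat]
        rw [dif_neg (by omega)]
        rfl
      rw [e2]
      simp [stp, hjn]

lemma ascentFree_psiH [Finite α] [OrderTop α] [PartialOrder L] (hrP : IsRankFunction rP)
    (lab : WithBot (WithTop α) → WithBot (WithTop α) → L)
    {g : Fin (n + 1) → Rees rP (rankT t n)} (hg : MC g) :
    AscentFree (reesLab rP (rankT t n) lab (fun _ _ => PUnit.unit)) (psiH g) ↔
      KC (fun j => wx lab (thF g) j ≤ wx lab (thF g) (j + 1)) false (thD g) := by
  unfold AscentFree
  change List.IsChain _ _ ↔ _
  rw [List.isChain_iff_getElem]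
  unfold KC
  have hlen : (labelSeq (reesLab rP (rankT t n) lab (fun _ _ => PUnit.unit)) (psiH g)).length
      = n + 2 := by
    rw [labelSeq_length, psiH_length]; rfl
  have hlab : ∀ j, j ≤ n + 1 → reesLab rP (rankT t n) lab (fun _ _ => PUnit.unit)
      (phat g j) (phat g (j + 1)) = (wx lab (thF g) j,
        if stp false (thD g) j = true then ((PUnit.unit : PUnit) : WithBot PUnit) else ⊥) := by
    intro j hj
    unfold reesLab wx
    rw [reesFst_phat, reesFst_phat]
    refine Prod.ext rfl ?_
    simp only [reesSnd_phat hrP hg j hj]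
  refine forall_congr' fun j => ?_
  by_cases hj : j ≤ n
  · have hj' : j + 1 < (labelSeq (reesLab rP (rankT t n) lab (fun _ _ => PUnit.unit))
      (psiH g)).length := by omega
    rw [forall_prop_of_true hj', forall_prop_of_true hj]
    rw [labelSeq_getElem, labelSeq_getElem]
    simp only [psiH_getElem]
    rw [hlab j (by omega), hlab (j + 1) (by omega), Prod.mk_le_mk]
    cases stp false (thD g) j <;> cases stp false (thD g) (j + 1) <;> simp
  · have hj' : ¬ j + 1 < (labelSeq (reesLab rP (rankT t n) lab (fun _ _ => PUnit.unit))
      (psiH g)).length := by omega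
    rw [forall_prop_of_false hj', forall_prop_of_false hj]

lemma last_ascent [OrderTop α] [PartialOrder L] (hn : 0 < n)
    (lab : WithBot (WithTop α) → WithBot (WithTop α) → L) (hEL : IsELLabeling lab)
    {F : Fin (n + 1) → α} (hF : MC F) : wx lab F n ≤ wx lab F (n + 1) := by
  obtain ⟨m, rfl⟩ : ∃ m, n = m + 1 := ⟨n - 1, by omega⟩
  have htop : F (Fin.last (m + 1)) = ⊤ := isMax_iff_eq_top.1 hF.2.2
  have hcov := hF.1 (Fin.last m)
  rw [Fin.succ_last, htop] at hcov
  set p := F (Fin.last m).castSucc with hp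
  have e1 : phat F (m + 1) = ((p : WithTop α) : WithBot (WithTop α)) := by
    simp only [phat]
    rw [dif_pos (by omega)]
    rfl
  have e2 : phat F (m + 1 + 1) = (((⊤ : α) : WithTop α) : WithBot (WithTop α)) := by
    simp only [phat]
    rw [dif_pos (by omega), ← htop]
    rfl
  have e3 : phat F (m + 1 + 1 + 1) = ((⊤ : WithTop α) : WithBot (WithTop α)) := by
    simp only [phat]
    rw [dif_neg (by omega)]
  unfold wx
  rw [e1, e2, e3]
  obtain ⟨c, ⟨hc, hh, hl⟩, hinc, -⟩ := hEL ((p : WithTop α) : WithBot (WithTop α))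
    ((⊤ : WithTop α) : WithBot (WithTop α)) (by exact_mod_cast le_top)
  have hc' : c.IsChain (· ⋖ ·) := hc
  have hinc' : (labelSeq lab c).IsChain (· ≤ ·) := hinc
  match c, hc', hh, hl, hinc' with
  | [], _, hh, _, _ => simp at hh
  | [a], _, hh, hl, _ =>
    simp at hh hl
    rw [hh] at hl
    simp at hl
  | a :: x :: c, hc', hh, hl, hinc' =>
    obtain rfl : a = _ := by simpa using hh
    rw [List.isChain_cons_cons] at hc'
    obtain ⟨h1, h2⟩ := hc'
    have hx : x = (((⊤ : α) : WithTop α) : WithBot (WithTop α)) := by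
      induction x using WithBot.recBotCoe with
      | bot => exact absurd h1.lt (by simp)
      | coe x =>
        rw [WithBot.coe_covBy_coe] at h1
        induction x using WithTop.recTopCoe with
        | top => exact absurd (WithTop.coe_covBy_top.1 h1) (fun h => h.not_lt hcov.lt)
        | coe x =>
          rw [WithTop.coe_covBy_coe] at h1
          have := (le_top (a := x)).eq_or_lt
          rcases this with h | h
          · rw [h]
          · exact absurd h (hcov.2 h1.lt)
    subst hx
    match c, h2, hl, hinc' with
    | [], _, hl, _ =>
      simp at hl
    | y :: c, h2, hl, hinc' =>
      rw [List.isChain_cons_cons] at h2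
      have hy : y = ((⊤ : WithTop α) : WithBot (WithTop α)) := by
        have h3 := h2.1.lt
        induction y using WithBot.recBotCoe with
        | bot => exact absurd h3 (by simp)
        | coe y =>
          induction y using WithTop.recTopCoe with
          | top => rfl
          | coe y =>
            rw [WithBot.coe_lt_coe, WithTop.coe_lt_coe] at h3
            exact absurd h3 (by simp)
      subst hy
      simp only [labelSeq, List.tail_cons, List.zipWith_cons_cons, List.isChain_cons_cons] at hinc'
      exact hinc'.1

end ReesChains

section Final

lemma ascF_eq {L : Type*} [PartialOrder L] {n : ℕ} (u : ℕ → L) :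
    ascF (fun i : Fin (n + 1) => u i) = Nat.count (fun j => u j ≤ u (j + 1)) n := by
  unfold ascF
  rw [Nat.count_eq_card_filter_range, Finset.card_filter, Finset.card_filter, Finset.sum_range]
  rfl

/-- The condition on words. -/
def WGood {L : Type*} [PartialOrder L] {n : ℕ} (hn : 0 < n) (w : Fin (n + 1) → L) : Prop :=
  NDAF w ∧ ¬w ⟨0, by omega⟩ ≤ w ⟨1, by omega⟩ ∧ ¬w ⟨n - 1, by omega⟩ ≤ w ⟨n, by omega⟩

lemma wGood_iff {L : Type*} [PartialOrder L] {n : ℕ} (hn : 0 < n) (u : ℕ → L) :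
    WGood hn (fun i : Fin (n + 1) => u i) ↔ GoodP (fun j => u j ≤ u (j + 1)) n := by
  unfold WGood GoodP NDAF
  have e : n - 1 + 1 = n := by omega
  simp only [hn, true_and, e]
  refine and_congr ⟨fun h i hi => h i (by omega), fun h i hi => h i (by omega)⟩ Iff.rfl

/-- The weight of a word. -/
noncomputable def wt {L : Type*} [PartialOrder L] (t : ℕ) {n : ℕ} (hn : 0 < n)
    (w : Fin (n + 1) → L) : ℕ :=
  if WGood hn w then t ^ (ascF w + 1) * (1 + t) ^ (n - 1 - 2 * ascF w) else 0

lemma card_rees {α L : Type*} [PartialOrder α] [Fintype α] [OrderTop α]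
    [PartialOrder L] (t n : ℕ) (hn : 0 < n) (rP : α → ℕ) (hrP : IsRankFunction rP)
    (lab : WithBot (WithTop α) → WithBot (WithTop α) → L) (hEL : IsELLabeling lab) :
    Nat.card {l : List (WithBot (WithTop (Rees rP (rankT t n)))) //
        IsMaximalChain l ∧
          AscentFree (reesLab rP (rankT t n) lab (fun _ _ => PUnit.unit)) l ∧
          l.length = n + 3} =
      ∑ F : Fin (n + 1) → α,
        if MC F then wt t hn (fun i : Fin (n + 1) => wx lab F i) else 0 := by
  rw [card_psiH n _ (fun l hl => hl.2)]
  have h1 : Nat.card {g : Fin (n + 1) → Rees rP (rankT t n) // MC g ∧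
        AscentFree (reesLab rP (rankT t n) lab (fun _ _ => PUnit.unit)) (psiH g) ∧
          (psiH g).length = n + 3} =
      Nat.card {x : (Fin (n + 1) → α) × (Fin n → Option (Fin t)) // MC x.1 ∧
        KC (fun j => wx lab x.1 j ≤ wx lab x.1 (j + 1)) false x.2} := by
    refine Nat.card_eq_of_bijective (fun g => ⟨(thF g.1, thD g.1),
      ((mc_rees hrP g.1).1 g.2.1).1, (ascentFree_psiH hrP lab g.2.1).1 g.2.2.1⟩) ⟨?_, ?_⟩
    · rintro ⟨g, hg⟩ ⟨g', hg'⟩ h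
      simp only [Subtype.mk.injEq, Prod.mk.injEq] at h
      exact Subtype.ext (th_injective hrP hg.1 hg'.1 h.1 h.2)
    · rintro ⟨⟨F, D⟩, hF, hD⟩
      obtain ⟨g, hg, rfl, rfl⟩ := th_surjective hrP hF D
      exact ⟨⟨g, hg, (ascentFree_psiH hrP lab hg).2 hD, psiH_length g⟩, rfl⟩
  rw [h1, Nat.card_eq_fintype_card, Fintype.card_subtype, Finset.card_filter,
    Fintype.sum_prod_type]
  refine Finset.sum_congr rfl fun F _ => ?_
  by_cases hF : MC F
  · rw [if_pos hF]
    have h2 := (CC_main t n (fun j => wx lab F j ≤ wx lab F (j + 1))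
      (last_ascent hn lab hEL hF)).1
    unfold wt
    rw [ascF_eq, wGood_iff, ← h2]
    unfold CC
    rw [Fintype.card_subtype, Finset.card_filter]
    refine Finset.sum_congr rfl fun D _ => ?_
    by_cases h3 : KC (fun j => wx lab F j ≤ wx lab F (j + 1)) false D
    · rw [if_pos h3, if_pos ⟨hF, h3⟩]
    · rw [if_neg h3, if_neg (fun h4 => h3 h4.2)]
  · rw [if_neg hF]
    refine Finset.sum_eq_zero fun D _ => ?_
    rw [if_neg (fun h4 => hF h4.1)]

lemma card_words {α L : Type*} [PartialOrder α] [Fintype α] [PartialOrder L]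
    (n : ℕ) (lab : WithBot (WithTop α) → WithBot (WithTop α) → L) (w : Fin (n + 1) → L) :
    Nat.card {l : List (WithBot α) // IsMaximalChain l ∧
              labelSeq (fun a b => lab (WithBot.map (fun x : α => (x : WithTop α)) a)
                (WithBot.map (fun x : α => (x : WithTop α)) b)) l = List.ofFn w} =
      ∑ F : Fin (n + 1) → α,
        if MC F ∧ (fun i : Fin (n + 1) => wx lab F i) = w then 1 else 0 := by
  rw [card_psiB n]
  · rw [← Finset.card_filter, ← Fintype.card_subtype, Nat.card_eq_fintype_card]
    refine Fintype.card_congr (Equiv.subtypeEquivRight fun F => ?_)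
    rw [labelSeq_psiB, List.ofFn_injective.eq_iff]
  · intro l hl
    have := congrArg List.length hl
    rw [labelSeq_length, List.length_ofFn] at this
    omega

end Final

/-- Theorem 3.3 of Linusson–Shareshian–Wachs. Let `P` be a finite
semipure poset of length `n` with a unique maximum element, `λ_P` an EL-labeling of `P̂`,
and let `λ` be the Rees-product EL-labeling of `(P ∗ T_{t,n})^` built from `λ_P` and the
constant (one-label) semi-EL-labeling of `T_{t,n}`.  The number of ascent-free maximal
chains of `(P ∗ T_{t,n})^` of length `n + 2` (i.e. with `n + 3` elements) equals
`∑ c(w) t^{asc(w)+1} (1+t)^{n-1-2 asc(w)}`, the sum over all words `w ∈ L_P^{n+1}` with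
no double ascent satisfying `w₁ ≰ w₂` and `w_n ≰ w_{n+1}`, where `c(w)` is the number of
maximal chains of `P ⊎ {0̂_P}` with label sequence `w`. -/
theorem statement_1 {α L : Type*} [PartialOrder α] [Fintype α] [OrderTop α]
    [PartialOrder L] [Fintype L]
    (t n : ℕ) (ht : 0 < t) (hn : 0 < n)
    (rP : α → ℕ) (hrP : IsRankFunction rP) (hlen : HasLength α n)
    (lab : WithBot (WithTop α) → WithBot (WithTop α) → L)
    (hEL : IsELLabeling lab) :
    Nat.card {l : List (WithBot (WithTop (Rees rP (rankT t n)))) //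
        IsMaximalChain l ∧
          AscentFree (reesLab rP (rankT t n) lab (fun _ _ => PUnit.unit)) l ∧
          l.length = n + 3} =
      ∑ w : Fin (n + 1) → L,
        if NDAF w ∧ ¬w ⟨0, by omega⟩ ≤ w ⟨1, by omega⟩ ∧
            ¬w ⟨n - 1, by omega⟩ ≤ w ⟨n, by omega⟩ then
          Nat.card {l : List (WithBot α) // IsMaximalChain l ∧
              labelSeq (fun a b => lab (WithBot.map (fun x : α => (x : WithTop α)) a)
                (WithBot.map (fun x : α => (x : WithTop α)) b)) l = List.ofFn w} *
            t ^ (ascF w + 1) * (1 + t) ^ (n - 1 - 2 * ascF w)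
        else 0 := by
  rw [card_rees t n hn rP hrP lab hEL]
  have hterm : ∀ w : Fin (n + 1) → L,
      (if NDAF w ∧ ¬w ⟨0, by omega⟩ ≤ w ⟨1, by omega⟩ ∧
            ¬w ⟨n - 1, by omega⟩ ≤ w ⟨n, by omega⟩ then
          Nat.card {l : List (WithBot α) // IsMaximalChain l ∧
              labelSeq (fun a b => lab (WithBot.map (fun x : α => (x : WithTop α)) a)
                (WithBot.map (fun x : α => (x : WithTop α)) b)) l = List.ofFn w} *
            t ^ (ascF w + 1) * (1 + t) ^ (n - 1 - 2 * ascF w)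
        else 0) =
      ∑ F : Fin (n + 1) → α,
        if (fun i : Fin (n + 1) => wx lab F i) = w then (if MC F then wt t hn w else 0) else 0 := by
    intro w
    rw [card_words]
    by_cases hw : WGood hn w
    · refine (if_pos hw).trans ?_
      rw [mul_assoc, Finset.sum_mul]
      refine Finset.sum_congr rfl fun F _ => ?_
      have hwt : wt t hn w = t ^ (ascF w + 1) * (1 + t) ^ (n - 1 - 2 * ascF w) := if_pos hw
      rw [hwt]
      by_cases h1 : MC F <;> by_cases h2 : (fun i : Fin (n + 1) => wx lab F i) = w <;>
        simp [h1, h2]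
    · refine (if_neg hw).trans ?_
      have hwt : wt t hn w = 0 := if_neg hw
      simp [hwt]
  rw [Finset.sum_congr rfl fun w _ => hterm w, Finset.sum_comm]
  refine Finset.sum_congr rfl fun F _ => ?_
  rw [Finset.sum_ite_eq]
  simp
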